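/- arXiv:2008.01796 — 9 statements merged into one kernel-verified Lean document; each statement's English description precedes it below -/
import Mathlib

section
/- Suppose r ≤ ε and that, after renumbering, α_j = α'_j and β_j = β'_j for j = 1,…,r (so α_1,…,α_r are error locators of e with corresponding error values β_1,…,β_r, and a_j = a'_j). Then (ω, σ) ∈ M_r(S_y; α_1,…,α_r; β_1,…,β_r); that is, ω ≡ S_y·σ (mod X^{d−1}), and for every j ∈ {1,…,r}: σ(α_j^{−1}) = 0 and β_j a_j σ'(α_j^{−1}) = −α_j ω(α_j^{−1}). -/
open Polynomial

noncomputable def synd {F : Type*} [Field F] (n d : ℕ) (ta : Fin n → F) (lam : F)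
    (y : Fin n → F) : F[X] :=
  ∑ j ∈ Finset.range (d - 1), C (∑ i : Fin n, ta i * y i * lam ^ ((i : ℕ) * j)) * X ^ j

/-- The module `M_r(S; α; β)` of the paper: pairs `(u,v)` with `u ≡ S v (mod X^{d-1})`,
`v(α_j⁻¹) = 0` and `β_j a_j v'(α_j⁻¹) = -α_j u(α_j⁻¹)` for all `j`. -/
def Mmod {F : Type*} [Field F] (d : ℕ) (S : F[X]) {r : ℕ} (α β a : Fin r → F) :
    Set (F[X] × F[X]) :=
  { uv | (X : F[X]) ^ (d - 1) ∣ uv.1 - S * uv.2 ∧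
      ∀ j : Fin r, uv.2.eval (α j)⁻¹ = 0 ∧
        β j * a j * ((derivative uv.2).eval (α j)⁻¹) = -(α j * uv.1.eval (α j)⁻¹) }

/-- The error-locator polynomial `σ(X) = ∏ᵢ (1 - αᵢ X)`. -/
noncomputable def elp {F : Type*} [Field F] {ε : ℕ} (α' : Fin ε → F) : F[X] :=
  ∏ i : Fin ε, (1 - C (α' i) * X)

/-- The error-evaluator polynomial `ω(X) = Σᵢ cᵢ ∏_{j≠i} (1 - αⱼ X)` (with `cᵢ = βᵢ aᵢ`). -/
noncomputable def eep {F : Type*} [Field F] {ε : ℕ} (α' c : Fin ε → F) : F[X] :=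
  ∑ i : Fin ε, C (c i) * ∏ j ∈ Finset.univ.erase i, (1 - C (α' j) * X)

theorem synd_add {F : Type*} [Field F] (n d : ℕ) (ta : Fin n → F) (lam : F) (x e : Fin n → F) :
    synd n d ta lam (x + e) = synd n d ta lam x + synd n d ta lam e := by
  simp only [synd, Pi.add_apply, mul_add, add_mul, Finset.sum_add_distrib, C_add]

/-- The syndrome of a word supported on the range of an injective map is a sum of truncated
geometric series. -/
theorem synd_eq_sum_geom {F : Type*} [Field F] (n d : ℕ) (ta : Fin n → F) (lam : F)
    (e : Fin n → F) {ε : ℕ} (loc : Fin ε → Fin n) (hloc : Function.Injective loc)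
    (hsupp : ∀ i : Fin n, e i ≠ 0 → ∃ k, loc k = i) :
    synd n d ta lam e = ∑ k : Fin ε, C (e (loc k) * ta (loc k)) *
      ∑ j ∈ Finset.range (d - 1), (C (lam ^ (loc k : ℕ)) * X) ^ j := by
  have key (j : ℕ) : ∑ i : Fin n, ta i * e i * lam ^ ((i : ℕ) * j) =
      ∑ k : Fin ε, ta (loc k) * e (loc k) * lam ^ ((loc k : ℕ) * j) := by
    refine (Fintype.sum_of_injective loc hloc _ _ (fun i hi => ?_) fun _ => rfl).symm
    have h0 : e i = 0 := by
      by_contra h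
      exact hi (hsupp i h)
    simp [h0]
  simp only [synd, key, map_sum, Finset.sum_mul, Finset.mul_sum]
  rw [Finset.sum_comm]
  refine Finset.sum_congr rfl fun k _ => Finset.sum_congr rfl fun j _ => ?_
  simp only [mul_pow, ← C_pow, ← pow_mul, C_mul]
  ring

theorem elp_eq_mul_prod_erase {F : Type*} [Field F] {ε : ℕ} (α : Fin ε → F) (k : Fin ε) :
    elp α = (1 - C (α k) * X) * ∏ j ∈ Finset.univ.erase k, (1 - C (α j) * X) :=
  (Finset.mul_prod_erase _ _ (Finset.mem_univ k)).symm

theorem X_pow_dvd_eep_sub_sum_geom_mul_elp {F : Type*} [Field F] {ε : ℕ} (m : ℕ)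
    (α c : Fin ε → F) :
    (X : F[X]) ^ m ∣ eep α c -
      (∑ k, C (c k) * ∑ j ∈ Finset.range m, (C (α k) * X) ^ j) * elp α := by
  rw [eep, Finset.sum_mul, ← Finset.sum_sub_distrib]
  refine Finset.dvd_sum fun k _ => ?_
  rw [elp_eq_mul_prod_erase α k]
  have hg := geom_sum_mul_neg (C (α k) * X) m
  refine ⟨C (c k) * (∏ j ∈ Finset.univ.erase k, (1 - C (α j) * X)) * C (α k) ^ m, ?_⟩
  rw [mul_pow] at hg
  linear_combination (-C (c k) * ∏ j ∈ Finset.univ.erase k, (1 - C (α j) * X)) * hg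

theorem eval_inv_elp {F : Type*} [Field F] {ε : ℕ} (α : Fin ε → F) (k : Fin ε) (hk : α k ≠ 0) :
    (elp α).eval (α k)⁻¹ = 0 := by
  simp [elp_eq_mul_prod_erase α k, hk]

theorem eval_inv_derivative_elp {F : Type*} [Field F] {ε : ℕ} (α : Fin ε → F) (k : Fin ε)
    (hk : α k ≠ 0) :
    (derivative (elp α)).eval (α k)⁻¹ =
      -(α k * (∏ j ∈ Finset.univ.erase k, (1 - C (α j) * X)).eval (α k)⁻¹) := by
  simp [elp_eq_mul_prod_erase α k, derivative_mul, hk]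

theorem eval_inv_eep {F : Type*} [Field F] {ε : ℕ} (α c : Fin ε → F) (k : Fin ε)
    (hk : α k ≠ 0) :
    (eep α c).eval (α k)⁻¹ =
      c k * (∏ j ∈ Finset.univ.erase k, (1 - C (α j) * X)).eval (α k)⁻¹ := by
  rw [eep, eval_finsetSum, Finset.sum_eq_single k]
  · simp
  · intro i _ hik
    rw [eval_mul, eval_prod, Finset.prod_eq_zero (i := k), mul_zero]
    · simp [hik.symm]
    · simp [hk]
  · simp

/-- If every nonzero element of `F` is a power of `lam`, then `lam ^ i ≠ 0` for `i < |F| - 1`;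
`lam = 0` is possible only when `|F| = 2`, which forces `i = 0`. -/
theorem pow_ne_zero_of_forall_eq_pow {F : Type*} [Field F] [Fintype F] {lam : F}
    (hlam : ∀ z : F, z ≠ 0 → ∃ k : ℕ, z = lam ^ k) {i : ℕ} (hi : i < Fintype.card F - 1) :
    lam ^ i ≠ 0 := by
  classical
  rcases eq_or_ne lam 0 with rfl | h
  · have hcard : Fintype.card F ≤ 2 := by
      rw [← Finset.card_univ]
      refine (Finset.card_le_card (t := {0, 1}) fun z _ => ?_).trans Finset.card_le_two
      by_cases hz : z = 0
      · simp [hz]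
      · obtain ⟨k, rfl⟩ := hlam z hz
        cases k <;> simp_all
    obtain rfl : i = 0 := by omega
    simp
  · exact pow_ne_zero i h

/-- if `y = x + e` with `S_x = 0`, `e` has exactly `ε` errors with locators
`α'_k = λ^{loc k}` and values `β'_k = e_{loc k}`, `r ≤ ε`, and `α_j = α'_j`, `β_j = β'_j`
for `j = 1,…,r`, then `(ω, σ) ∈ M_r(S_y; α₁,…,α_r; β₁,…,β_r)`. -/
theorem stmt1 {F : Type*} [Field F] [Fintype F]
    (n d : ℕ) (hn : n = Fintype.card F - 1) (hd : 2 ≤ d)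
    (lam : F) (hlam : ∀ z : F, z ≠ 0 → ∃ k : ℕ, z = lam ^ k)
    (ta : Fin n → F) (hta : ∀ i, ta i ≠ 0)
    (x e y : Fin n → F) (hy : y = x + e)
    (hx : synd n d ta lam x = 0)
    (ε : ℕ) (loc : Fin ε → Fin n) (hloc : Function.Injective loc)
    (hsupp : ∀ i : Fin n, e i ≠ 0 ↔ ∃ k, loc k = i)
    (r : ℕ) (hr : r ≤ ε) :
    (eep (fun k => lam ^ ((loc k : ℕ))) (fun k => e (loc k) * ta (loc k)),
      elp (fun k => lam ^ ((loc k : ℕ))))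
      ∈ Mmod d (synd n d ta lam y)
          (fun j : Fin r => lam ^ ((loc (Fin.castLE hr j) : ℕ)))
          (fun j : Fin r => e (loc (Fin.castLE hr j)))
          (fun j : Fin r => ta (loc (Fin.castLE hr j))) := by
  have hα (k : Fin ε) : lam ^ (loc k : ℕ) ≠ 0 :=
    pow_ne_zero_of_forall_eq_pow hlam (hn ▸ (loc k).isLt)
  refine ⟨?_, fun j => ⟨eval_inv_elp (fun k => lam ^ (loc k : ℕ)) (Fin.castLE hr j) (hα _), ?_⟩⟩
  · rw [hy, synd_add, hx, zero_add,
      synd_eq_sum_geom n d ta lam e loc hloc fun i => (hsupp i).1]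
    exact X_pow_dvd_eep_sub_sum_geom_mul_elp (d - 1) _ _
  · have h1 := eval_inv_derivative_elp (fun k => lam ^ (loc k : ℕ)) (Fin.castLE hr j) (hα _)
    have h2 := eval_inv_eep (fun k => lam ^ (loc k : ℕ))
      (fun k => e (loc k) * ta (loc k)) (Fin.castLE hr j) (hα _)
    dsimp only at h1 h2 ⊢
    rw [h1, h2]
    ring
end

section
/- Suppose r ≥ 1 and that α_r is an error locator of e with corresponding error value β_r (so subtracting β_r from the coordinate of y at the position i' with λ^{i'} = α_r gives a vector ỹ whose error vector has one fewer nonzero coordinate). For (u,v) ∈ M_r(S_y; α_1,…,α_r; β_1,…,β_r), set ṽ := v/(1−α_r X) and h̃ := (u − β_r a_r ṽ)/(1−α_r X) (both divisions are exact). Then the map ψ : (u,v) ↦ (h̃, ṽ) maps M_r(S_y; α_1,…,α_r; β_1,…,β_r) into M_{r−1}(S_ỹ; α_1,…,α_{r−1}; β_1,…,β_{r−1}). -/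
open Polynomial

/-- Changing one coordinate of `y` changes the syndrome by a truncated geometric series. -/
lemma synd_update_sub {F : Type*} [Field F] (n d : ℕ) (ta : Fin n → F) (lam : F)
    (y : Fin n → F) (i : Fin n) (b : F) :
    synd n d ta lam (Function.update y i (y i - b)) = synd n d ta lam y -
      C (b * ta i) * ∑ j ∈ Finset.range (d - 1), (C (lam ^ (i : ℕ)) * X) ^ j := by
  have coord (k : Fin n) (j : ℕ) :
      ta k * Function.update y i (y i - b) k * lam ^ ((k : ℕ) * j) =
        ta k * y k * lam ^ ((k : ℕ) * j) -
          if k = i then b * ta i * lam ^ ((i : ℕ) * j) else 0 := by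
    by_cases h : k = i
    · subst h
      simp only [Function.update_self, if_true]
      ring
    · simp [h]
  unfold synd
  rw [Finset.mul_sum, ← Finset.sum_sub_distrib]
  refine Finset.sum_congr rfl fun j _ => ?_
  simp only [coord, Finset.sum_sub_distrib, Finset.sum_ite_eq', Finset.mem_univ, if_true]
  rw [mul_pow, ← C_pow, ← pow_mul, C_sub, C_mul (a := b * ta i)]
  ring

/-- A linear polynomial with constant term one is coprime to every power of `X`. -/
lemma isCoprime_X_pow_one_sub_C_mul_X {F : Type*} [Field F] (m : ℕ) (c : F) :
    IsCoprime ((X : F[X]) ^ m) (1 - C c * X) :=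
  IsCoprime.pow_left ⟨C c, 1, by ring⟩

/-- the map `ψ : (u,v) ↦ (h̃, ṽ)`, where `ṽ = v/(1-α_r X)` and
`h̃ = (u - β_r a_r ṽ)/(1-α_r X)`, maps `M_r(S_y; α₁,…,α_r; β₁,…,β_r)` into
`M_{r-1}(S_ỹ; α₁,…,α_{r-1}; β₁,…,β_{r-1})`, where `ỹ` is obtained from `y` by
subtracting `β_r` from the coordinate at the position `i'` with `λ^{i'} = α_r`. -/
theorem stmt4 {F : Type*} [Field F] [Fintype F]
    (n d : ℕ) (hn : n = Fintype.card F - 1) (hd : 2 ≤ d)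
    (lam : F) (hlam : ∀ z : F, z ≠ 0 → ∃ k : ℕ, z = lam ^ k)
    (ta : Fin n → F) (hta : ∀ i, ta i ≠ 0)
    (y : Fin n → F)
    (r : ℕ)
    (α β : Fin (r + 1) → F) (hα0 : ∀ j, α j ≠ 0) (hαinj : Function.Injective α)
    (hβ : ∀ j, β j ≠ 0)
    (a : Fin (r + 1) → F)
    (ha : ∀ (j : Fin (r + 1)) (i : Fin n), α j = lam ^ (i : ℕ) → a j = ta i)
    (i' : Fin n) (hi' : α (Fin.last r) = lam ^ (i' : ℕ))
    (u v tv th : F[X])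
    (huv : (u, v) ∈ Mmod d (synd n d ta lam y) α β a)
    (htv : v = (1 - C (α (Fin.last r)) * X) * tv)
    (hth : u - C (β (Fin.last r) * a (Fin.last r)) * tv
      = (1 - C (α (Fin.last r)) * X) * th) :
    (th, tv) ∈ Mmod d
      (synd n d ta lam (Function.update y i' (y i' - β (Fin.last r))))
      (α ∘ Fin.castSucc) (β ∘ Fin.castSucc) (a ∘ Fin.castSucc) := by
  obtain ⟨hdvd, hroot⟩ := huv
  have hc : a (Fin.last r) = ta i' := ha _ _ hi'
  refine ⟨?_, fun j => ?_⟩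
  · refine (isCoprime_X_pow_one_sub_C_mul_X (d - 1) (α (Fin.last r))).dvd_of_dvd_mul_left ?_
    have hgeom := mul_neg_geom_sum (C (α (Fin.last r)) * X) (d - 1)
    have key : (1 - C (α (Fin.last r)) * X) *
        (th - synd n d ta lam (Function.update y i' (y i' - β (Fin.last r))) * tv) =
        (u - synd n d ta lam y * v) - X ^ (d - 1) *
          (C (β (Fin.last r) * a (Fin.last r)) * C (α (Fin.last r)) ^ (d - 1) * tv) := by
      rw [synd_update_sub, ← hi', ← hc, htv]
      rw [mul_pow] at hgeom
      linear_combination -hth + C (β (Fin.last r) * a (Fin.last r)) * tv * hgeom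
    rw [key]
    exact dvd_sub hdvd (dvd_mul_right _ _)
  · obtain ⟨hv, hd'⟩ := hroot j.castSucc
    have hne : 1 - α (Fin.last r) * (α j.castSucc)⁻¹ ≠ 0 := fun h =>
      (Fin.castSucc_lt_last j).ne' (hαinj ((mul_inv_eq_one₀ (hα0 _)).1 (sub_eq_zero.1 h).symm))
    have htv0 : tv.eval (α j.castSucc)⁻¹ = 0 := by
      simpa [htv, hne] using hv
    have hu := congrArg (eval (α j.castSucc)⁻¹) hth
    simp only [eval_sub, eval_mul, eval_C, eval_one, eval_X, htv0, mul_zero, sub_zero] at hu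
    refine ⟨htv0, mul_left_cancel₀ hne ?_⟩
    simp only [htv, hu, derivative_mul, derivative_sub, derivative_one, derivative_C,
      derivative_X, eval_add, eval_mul, eval_sub, eval_one, eval_C, eval_X, htv0,
      mul_zero, zero_add] at hd'
    simp only [Function.comp_apply]
    linear_combination hd'
end

section
/- Let S ∈ F[X] and d ≥ 2, and suppose (u,v) and (ũ,ṽ) both satisfy the key-equation congruence u ≡ S·v (mod X^{d−1}) and ũ ≡ S·ṽ (mod X^{d−1}). Suppose further that there are d_1, d_2 ∈ ℕ with d_1 + d_2 < d−1 such that deg u ≤ d_1, deg ũ ≤ d_1, deg v ≤ d_2, deg ṽ ≤ d_2, and that gcd(ũ,ṽ) = 1. Then there exists a polynomial f ∈ F[X] with u = f·ũ and v = f·ṽ. -/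
open Polynomial

/-- if `(u,v)` and `(ũ,ṽ)` both satisfy the key-equation congruence modulo
`X^{d-1}`, with degree bounds `deg u, deg ũ ≤ d₁`, `deg v, deg ṽ ≤ d₂`, `d₁ + d₂ < d-1`,
and `gcd(ũ,ṽ) = 1`, then `(u,v) = f·(ũ,ṽ)` for some polynomial `f`. -/
theorem stmt7 {F : Type*} [Field F] (S : F[X]) (d : ℕ) (hd : 2 ≤ d)
    (u v tu tv : F[X])
    (hcong : (X : F[X]) ^ (d - 1) ∣ u - S * v)
    (htcong : (X : F[X]) ^ (d - 1) ∣ tu - S * tv)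
    (d1 d2 : ℕ) (hsum : d1 + d2 < d - 1)
    (hu : u.degree ≤ d1) (htu : tu.degree ≤ d1)
    (hv : v.degree ≤ d2) (htv : tv.degree ≤ d2)
    (hcop : IsCoprime tu tv) :
    ∃ f : F[X], u = f * tu ∧ v = f * tv := by
  have hdvd : (X : F[X]) ^ (d - 1) ∣ u * tv - tu * v := by
    have h := (hcong.mul_right tv).sub (htcong.mul_right v)
    convert h using 1
    ring
  have hdeg : (u * tv - tu * v).degree < ((X : F[X]) ^ (d - 1)).degree := by
    rw [degree_X_pow]
    refine lt_of_le_of_lt (b := ((d1 + d2 : ℕ) : WithBot ℕ)) ?_ (by exact_mod_cast hsum)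
    rw [Nat.cast_add]
    exact (degree_sub_le _ _).trans
      (max_le (degree_mul_le_of_le hu htv) (degree_mul_le_of_le htu hv))
  have hcross : u * tv - tu * v = 0 := eq_zero_of_dvd_of_degree_lt hdvd hdeg
  obtain ⟨a, b, hab⟩ := hcop
  refine ⟨a * u + b * v, ?_, ?_⟩
  · linear_combination b * hcross - u * hab
  · linear_combination -a * hcross - v * hab
end

section
/- Let S ∈ F[X], let α_1,…,α_{r+1} ∈ F* be distinct, and let β_1,…,β_{r+1} ∈ F*. Define M_{r+1/2} := M_r(S; α_1,…,α_r; β_1,…,β_r) ∩ {(u,v) ∈ F[X]^2 : v(α_{r+1}^{−1}) = 0}. Then both inclusions M_r(S; α_1,…,α_r; β_1,…,β_r) ⊇ M_{r+1/2} ⊇ M_{r+1}(S; α_1,…,α_{r+1}; β_1,…,β_{r+1}) are strict. -/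
open Polynomial

/-- There is a polynomial vanishing at the inverses of all but the last of finitely many
distinct elements of a field. -/
theorem exists_eval_inv_castSucc_eq_zero {F : Type*} [Field F] {r : ℕ}
    {α : Fin (r + 1) → F} (hα : Function.Injective α) :
    ∃ P : F[X], (∀ j : Fin r, P.eval (α j.castSucc)⁻¹ = 0) ∧
      P.eval (α (Fin.last r))⁻¹ ≠ 0 := by
  refine ⟨∏ j : Fin r, (X - C (α j.castSucc)⁻¹), fun j => ?_, ?_⟩
  · rw [eval_prod]
    exact Finset.prod_eq_zero (Finset.mem_univ j) (by simp)
  · rw [eval_prod, Finset.prod_ne_zero_iff]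
    intro j _ h
    simp only [eval_sub, eval_X, eval_C, sub_eq_zero, inv_inj] at h
    exact (Fin.castSucc_lt_last j).ne (hα h).symm

/-- with `M_{r+1/2} := M_r ∩ {(u,v) : v(α_{r+1}⁻¹) = 0}`, both inclusions
`M_r ⊇ M_{r+1/2} ⊇ M_{r+1}` are strict. -/
theorem stmt9 {F : Type*} [Field F] [Fintype F]
    (n d : ℕ) (hn : n = Fintype.card F - 1) (hd : 2 ≤ d)
    (lam : F) (hlam : ∀ z : F, z ≠ 0 → ∃ k : ℕ, z = lam ^ k)
    (ta : Fin n → F) (hta : ∀ i, ta i ≠ 0)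
    (S : F[X]) (r : ℕ)
    (α β : Fin (r + 1) → F) (hα0 : ∀ j, α j ≠ 0) (hαinj : Function.Injective α)
    (hβ : ∀ j, β j ≠ 0)
    (a : Fin (r + 1) → F)
    (ha : ∀ (j : Fin (r + 1)) (i : Fin n), α j = lam ^ (i : ℕ) → a j = ta i) :
    (Mmod d S (α ∘ Fin.castSucc) (β ∘ Fin.castSucc) (a ∘ Fin.castSucc) ∩
        {uv : F[X] × F[X] | uv.2.eval (α (Fin.last r))⁻¹ = 0})
      ⊂ Mmod d S (α ∘ Fin.castSucc) (β ∘ Fin.castSucc) (a ∘ Fin.castSucc) ∧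
    Mmod d S α β a
      ⊂ Mmod d S (α ∘ Fin.castSucc) (β ∘ Fin.castSucc) (a ∘ Fin.castSucc) ∩
          {uv : F[X] × F[X] | uv.2.eval (α (Fin.last r))⁻¹ = 0} := by
  obtain ⟨P, hP, hPlast⟩ := exists_eval_inv_castSucc_eq_zero hαinj
  refine ⟨Set.ssubset_iff_of_subset Set.inter_subset_left |>.2
      ⟨(S * P ^ 2, P ^ 2), ⟨by simp, fun j => ?_⟩, ?_⟩,
    Set.ssubset_iff_of_subset ?_ |>.2
      ⟨(X ^ (d - 1) * P, 0), ⟨⟨by simp, fun j => ?_⟩, by simp⟩, ?_⟩⟩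
  · simp [derivative_pow, hP j]
  · rintro ⟨-, h⟩
    exact hPlast (by simpa using h)
  · rintro uv ⟨hdvd, h⟩
    exact ⟨⟨hdvd, fun j => h j.castSucc⟩, (h (Fin.last r)).1⟩
  · simp [hP j]
  · rintro ⟨-, h⟩
    simpa [hα0, hPlast] using (h (Fin.last r)).2
end

section
/- Let t ≥ 1, let S ∈ F[X], and let M_0 = {(u,v) ∈ F[X]^2 : u ≡ S·v (mod X^{2t})}. Suppose h_0 = (h_{00}, h_{01}) and h_1 = (h_{10}, h_{11}) generate M_0 as an F[X]-module, with h_{00} ≠ 0, h_{11} ≠ 0, deg h_{00} ≥ deg h_{01} (the leading monomial of h_0 is on the left) and deg h_{11} ≥ deg h_{10} + 1 (the leading monomial of h_1 is on the right; here deg 0 := −∞). Then deg h_{00} + deg h_{11} = 2t. -/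
open Polynomial

/-- If two vectors generate the module `{(u, v) | N ∣ u - S * v}`, then their determinant is
associated to `N`. -/
theorem associated_det_of_generate {R : Type*} [CommRing R] [IsDomain R] {N S a b c d : R}
    (h₀ : N ∣ a - S * b) (h₁ : N ∣ c - S * d)
    (hgen : ∀ u v : R, N ∣ u - S * v → ∃ f g : R, u = f * a + g * c ∧ v = f * b + g * d) :
    Associated (a * d - c * b) N := by
  obtain ⟨p, q, hN, hz⟩ := hgen N 0 (by simp)
  obtain ⟨r, s, -, ho⟩ := hgen S 1 (by simp)
  refine associated_of_dvd_dvd ⟨p * s - q * r, ?_⟩ ?_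
  · linear_combination (r * b + s * d) * hN - (r * a + s * c) * hz + N * ho
  · have key : a * d - c * b = (a - S * b) * d - (c - S * d) * b := by ring
    rw [key]
    exact dvd_sub (h₀.mul_right d) (h₁.mul_right b)

/-- A strictly smaller antidiagonal does not affect the degree of a determinant. -/
theorem Polynomial.natDegree_det_of_degree_lt {R : Type*} [CommRing R] [IsDomain R]
    {a b c d : R[X]} (ha : a ≠ 0) (hd : d ≠ 0) (hba : b.degree ≤ a.degree)
    (hcd : c.degree < d.degree) :
    (a * d - c * b).natDegree = a.natDegree + d.natDegree := by
  have hlt : (c * b).degree < (a * d).degree := by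
    rw [degree_mul, degree_mul, add_comm a.degree]
    exact (add_le_add_right hba c.degree).trans_lt
      (WithBot.add_lt_add_right (degree_ne_bot.mpr ha) hcd)
  rw [natDegree_eq_of_degree_eq (degree_sub_eq_left_of_degree_lt hlt), natDegree_mul ha hd]

/-- if `h₀ = (h₀₀,h₀₁)` and `h₁ = (h₁₀,h₁₁)` generate
`M₀ = {(u,v) : u ≡ S v (mod X^{2t})}` as an `F[X]`-module, with the leading monomial of
`h₀` on the left (`deg h₀₀ ≥ deg h₀₁`) and that of `h₁` on the right
(`deg h₁₁ ≥ deg h₁₀ + 1`), then `deg h₀₀ + deg h₁₁ = 2t`. -/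
theorem stmt10 {F : Type*} [Field F] (t : ℕ) (ht : 1 ≤ t) (S : F[X])
    (h00 h01 h10 h11 : F[X])
    (hm0 : (X : F[X]) ^ (2 * t) ∣ h00 - S * h01)
    (hm1 : (X : F[X]) ^ (2 * t) ∣ h10 - S * h11)
    (hgen : ∀ u v : F[X], (X : F[X]) ^ (2 * t) ∣ u - S * v →
      ∃ f0 f1 : F[X], u = f0 * h00 + f1 * h10 ∧ v = f0 * h01 + f1 * h11)
    (h00ne : h00 ≠ 0) (h11ne : h11 ≠ 0)
    (hd0 : h01.degree ≤ h00.degree)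
    (hd1 : h10.degree + 1 ≤ h11.degree) :
    h00.natDegree + h11.natDegree = 2 * t := by
  have hlt : h10.degree < h11.degree := by
    rcases eq_or_ne h10 0 with rfl | h10ne
    · simpa [bot_lt_iff_ne_bot] using h11ne
    · rw [degree_eq_natDegree h10ne, degree_eq_natDegree h11ne] at hd1 ⊢
      norm_cast at hd1 ⊢
  have hassoc := associated_det_of_generate hm0 hm1 hgen
  rw [← natDegree_det_of_degree_lt h00ne h11ne hd0 hlt,
    natDegree_eq_of_degree_eq (degree_eq_degree_of_associated hassoc), natDegree_X_pow]
end

section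
/- Let h_0 = (h_{00}, h_{01}) and h_1 = (h_{10}, h_{11}) be elements of M_0(S_y), and let f_0, f_1 ∈ F[X]. Then the pair f_0·h_0 + f_1·h_1 belongs to M_r(S_y; α_1,…,α_r; β_1,…,β_r) if and only if for every i ∈ {1,…,r} the following two equations hold: (1) b_{0i} f_0(α_i^{−1}) + b_{1i} f_1(α_i^{−1}) = 0, and (2) b_{0i} f_0'(α_i^{−1}) + c_{0i} f_0(α_i^{−1}) + b_{1i} f_1'(α_i^{−1}) + c_{1i} f_1(α_i^{−1}) = 0, where b_{0i} := h_{01}(α_i^{−1}), b_{1i} := h_{11}(α_i^{−1}), c_{0i} := h_{01}'(α_i^{−1}) + (α_i/(β_i a_i)) h_{00}(α_i^{−1}), and c_{1i} := h_{11}'(α_i^{−1}) + (α_i/(β_i a_i)) h_{10}(α_i^{−1}). -/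
open Polynomial

/-- for `h₀ = (h₀₀,h₀₁), h₁ = (h₁₀,h₁₁) ∈ M₀(S_y)` and `f₀, f₁ ∈ F[X]`,
the combination `f₀·h₀ + f₁·h₁` lies in `M_r(S_y; α; β)` iff for every `i ≤ r` the two
linear conditions of Proposition `nr` hold. -/
theorem stmt13 {F : Type*} [Field F] [Fintype F]
    (n d : ℕ) (hn : n = Fintype.card F - 1) (hd : 2 ≤ d)
    (lam : F) (hlam : ∀ z : F, z ≠ 0 → ∃ k : ℕ, z = lam ^ k)
    (ta : Fin n → F) (hta : ∀ i, ta i ≠ 0)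
    (y : Fin n → F)
    (r : ℕ) (α β : Fin r → F) (hα0 : ∀ j, α j ≠ 0) (hαinj : Function.Injective α)
    (hβ : ∀ j, β j ≠ 0)
    (a : Fin r → F) (ha : ∀ (j : Fin r) (i : Fin n), α j = lam ^ (i : ℕ) → a j = ta i)
    (ha0 : ∀ j, a j ≠ 0)
    (h00 h01 h10 h11 : F[X])
    (hm0 : (X : F[X]) ^ (d - 1) ∣ h00 - synd n d ta lam y * h01)
    (hm1 : (X : F[X]) ^ (d - 1) ∣ h10 - synd n d ta lam y * h11)
    (f0 f1 : F[X]) :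
    (f0 * h00 + f1 * h10, f0 * h01 + f1 * h11) ∈ Mmod d (synd n d ta lam y) α β a ↔
      ∀ i : Fin r,
        (h01.eval (α i)⁻¹ * f0.eval (α i)⁻¹ + h11.eval (α i)⁻¹ * f1.eval (α i)⁻¹ = 0) ∧
        (h01.eval (α i)⁻¹ * (derivative f0).eval (α i)⁻¹
          + ((derivative h01).eval (α i)⁻¹ + α i / (β i * a i) * h00.eval (α i)⁻¹)
              * f0.eval (α i)⁻¹
          + h11.eval (α i)⁻¹ * (derivative f1).eval (α i)⁻¹
          + ((derivative h11).eval (α i)⁻¹ + α i / (β i * a i) * h10.eval (α i)⁻¹)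
              * f1.eval (α i)⁻¹ = 0) := by
  have hdvd : (X : F[X]) ^ (d - 1) ∣
      (f0 * h00 + f1 * h10) - synd n d ta lam y * (f0 * h01 + f1 * h11) := by
    convert dvd_add (hm0.mul_left f0) (hm1.mul_left f1) using 1
    ring
  simp only [Mmod, Set.mem_ofPred_eq, hdvd, true_and]
  refine forall_congr' fun i => and_congr ?_ ?_
  · simp only [eval_add, eval_mul, mul_comm]
  · have hb := hβ i
    have ha' := ha0 i
    simp only [derivative_add, derivative_mul, eval_add, eval_mul]
    generalize (α i)⁻¹ = x
    rw [← sub_eq_zero]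
    refine Iff.trans (Eq.congr ?_ rfl) (mul_eq_zero_iff_left (mul_ne_zero hb ha'))
    field_simp
    ring
end

section
/- Let h_0 = (h_{00}, h_{01}) and h_1 = (h_{10}, h_{11}) be a free F[X]-module basis of M_0(S_y) with deg h_{00} ≥ deg h_{01} (leading monomial of h_0 on the left for <_{−1}) and deg h_{11} > deg h_{10} (leading monomial of h_1 on the right for <_{−1}), and set w := deg h_{11} − deg h_{00} − 1. Then for all nonzero pairs (f_0, f_1), (g_0, g_1) ∈ F[X]^2: lm_{−1}(f_0 h_0 + f_1 h_1) <_{−1} lm_{−1}(g_0 h_0 + g_1 h_1) if and only if lm_w(f_0, f_1) <_w lm_w(g_0, g_1). -/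
open Polynomial

/-- Degree of a polynomial, as an element of `WithBot ℤ` (so `deg 0 = ⊥ = -∞`). -/
noncomputable def degZ {F : Type*} [Field F] (p : F[X]) : WithBot ℤ :=
  p.degree.map (fun k : ℕ => (k : ℤ))

/-- The monomial ordering `<_w` on monomials of `F[X]²`: `Sum.inl i` stands for the
monomial `(X^i, 0)` and `Sum.inr j` for `(0, X^j)`. -/
def monLt (w : ℤ) : ℕ ⊕ ℕ → ℕ ⊕ ℕ → Prop
  | Sum.inl i, Sum.inl j => i < j
  | Sum.inr i, Sum.inr j => i < j
  | Sum.inl i, Sum.inr j => (i : ℤ) ≤ (j : ℤ) + w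
  | Sum.inr i, Sum.inl j => (i : ℤ) + w < (j : ℤ)

def monLe (w : ℤ) (m m' : ℕ ⊕ ℕ) : Prop := monLt w m m' ∨ m = m'

/-- The `<_w`-leading monomial of a (nonzero) pair `(u,v) ∈ F[X]²`:
`(X^{deg u}, 0)` if `deg u ≥ deg v + w + 1`, and `(0, X^{deg v})` otherwise. -/
noncomputable def lm {F : Type*} [Field F] (w : ℤ) (u v : F[X]) : ℕ ⊕ ℕ :=
  if degZ v + (w : WithBot ℤ) + 1 ≤ degZ u then Sum.inl u.natDegree else Sum.inr v.natDegree

theorem degZ_add_le_degZ_iff {F : Type*} [Field F] {w : ℤ} {p q : F[X]} (hp : p ≠ 0)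
    (hq : q ≠ 0) (hw : w = (q.natDegree : ℤ) - (p.natDegree : ℤ) - 1) (u v : F[X]) :
    degZ v + (w : WithBot ℤ) + 1 ≤ degZ u ↔ (v * q).degree ≤ (u * p).degree := by
  have degZ_eq (r : F[X]) (hr : r ≠ 0) : degZ r = ((r.natDegree : ℤ) : WithBot ℤ) := by
    rw [degZ, degree_eq_natDegree hr]
    rfl
  have degZ_zero : degZ (0 : F[X]) = ⊥ := by
    rw [degZ, degree_zero]
    rfl
  by_cases hv : v = 0
  · simp [hv, degZ_zero]
  by_cases hu : u = 0
  · subst hu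
    rw [degZ_zero, degZ_eq v hv, zero_mul, degree_zero, le_bot_iff, le_bot_iff, degree_eq_bot]
    refine iff_of_false ?_ (mul_ne_zero hv hq)
    exact_mod_cast WithBot.coe_ne_bot
  rw [degZ_eq v hv, degZ_eq u hu, degree_eq_natDegree (mul_ne_zero hv hq),
    degree_eq_natDegree (mul_ne_zero hu hp), natDegree_mul hv hq, natDegree_mul hu hp,
    Nat.cast_le]
  norm_cast
  omega

theorem lm_eq_ite {F : Type*} [Field F] {w : ℤ} {p q : F[X]} (hp : p ≠ 0)
    (hq : q ≠ 0) (hw : w = (q.natDegree : ℤ) - (p.natDegree : ℤ) - 1) (u v : F[X]) :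
    lm w u v = if (v * q).degree ≤ (u * p).degree then Sum.inl u.natDegree
      else Sum.inr v.natDegree := by
  simp only [lm, degZ_add_le_degZ_iff hp hq hw]

theorem lm_neg_one_combination {F : Type*} [Field F] {h00 h01 h10 h11 : F[X]} {w : ℤ}
    (h00ne : h00 ≠ 0) (hd0 : h01.degree ≤ h00.degree) (hd1 : h10.degree < h11.degree)
    (hw : w = (h11.natDegree : ℤ) - (h00.natDegree : ℤ) - 1)
    {f0 f1 : F[X]} (hf : (f0, f1) ≠ (0, 0)) :
    lm (-1) (f0 * h00 + f1 * h10) (f0 * h01 + f1 * h11) =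
      (lm w f0 f1).map (· + h00.natDegree) (· + h11.natDegree) := by
  have h11ne : h11 ≠ 0 := ne_zero_of_degree_gt hd1
  rw [lm_eq_ite (p := 1) (q := 1) one_ne_zero one_ne_zero (by simp),
    lm_eq_ite h00ne h11ne hw, mul_one, mul_one]
  have hle0 : (f0 * h01).degree ≤ (f0 * h00).degree := by
    rw [degree_mul, degree_mul]
    gcongr
  have hle1 : (f1 * h10).degree ≤ (f1 * h11).degree := by
    rw [degree_mul, degree_mul]
    gcongr
  have hlt1 (h : f1 ≠ 0) : (f1 * h10).degree < (f1 * h11).degree := by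
    rw [degree_mul, degree_mul]
    exact WithBot.add_lt_add_left (degree_ne_bot.mpr h) hd1
  by_cases hc : (f1 * h11).degree ≤ (f0 * h00).degree
  · have f0ne : f0 ≠ 0 := by
      rintro rfl
      simp_all
    have hlt : (f1 * h10).degree < (f0 * h00).degree := by
      by_cases h : f1 = 0
      · rw [h, zero_mul, degree_zero, bot_lt_iff_ne_bot, degree_ne_bot]
        exact mul_ne_zero f0ne h00ne
      · exact (hlt1 h).trans_le hc
    have hu := degree_add_eq_left_of_degree_lt hlt
    rw [if_pos hc, if_pos, natDegree_eq_of_degree_eq hu, natDegree_mul f0ne h00ne, Sum.map_inl]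
    rw [hu]
    exact (degree_add_le _ _).trans (max_le hle0 hc)
  · have hlt := not_le.mp hc
    have f1ne : f1 ≠ 0 := by
      rintro rfl
      simp at hc
    have hv := degree_add_eq_right_of_degree_lt (hle0.trans_lt hlt)
    rw [if_neg hc, if_neg, natDegree_eq_of_degree_eq hv, natDegree_mul f1ne h11ne, Sum.map_inr]
    rw [hv, not_le]
    exact (degree_add_le _ _).trans_lt (max_lt hlt (hlt1 f1ne))

theorem monLt_neg_one_map_add_iff {w : ℤ} {a b : ℕ} (hw : w = (b : ℤ) - (a : ℤ) - 1)
    (m m' : ℕ ⊕ ℕ) :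
    monLt (-1) (m.map (· + a) (· + b)) (m'.map (· + a) (· + b)) ↔ monLt w m m' := by
  rcases m with i | i <;> rcases m' with j | j <;>
    simp only [Sum.map_inl, Sum.map_inr, monLt] <;> omega

/-- if `h₀, h₁` is a free `F[X]`-basis of `M₀(S_y)` with the leading monomial
of `h₀` on the left and that of `h₁` on the right (for `<_{-1}`), and
`w = deg h₁₁ - deg h₀₀ - 1`, then for nonzero `(f₀,f₁), (g₀,g₁)`:
`lm_{-1}(f₀h₀+f₁h₁) <_{-1} lm_{-1}(g₀h₀+g₁h₁)` iff `lm_w(f₀,f₁) <_w lm_w(g₀,g₁)`. -/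
theorem stmt14 {F : Type*} [Field F] [Fintype F]
    (n d : ℕ) (hn : n = Fintype.card F - 1) (hd : 2 ≤ d)
    (lam : F) (hlam : ∀ z : F, z ≠ 0 → ∃ k : ℕ, z = lam ^ k)
    (ta : Fin n → F) (hta : ∀ i, ta i ≠ 0)
    (y : Fin n → F)
    (h00 h01 h10 h11 : F[X])
    (hm0 : (X : F[X]) ^ (d - 1) ∣ h00 - synd n d ta lam y * h01)
    (hm1 : (X : F[X]) ^ (d - 1) ∣ h10 - synd n d ta lam y * h11)
    (hfree : ∀ u v : F[X], (X : F[X]) ^ (d - 1) ∣ u - synd n d ta lam y * v →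
      ∃! fg : F[X] × F[X], u = fg.1 * h00 + fg.2 * h10 ∧ v = fg.1 * h01 + fg.2 * h11)
    (h00ne : h00 ≠ 0)
    (hd0 : h01.degree ≤ h00.degree)
    (hd1 : h10.degree < h11.degree)
    (w : ℤ) (hw : w = (h11.natDegree : ℤ) - (h00.natDegree : ℤ) - 1) :
    ∀ f0 f1 g0 g1 : F[X], (f0, f1) ≠ (0, 0) → (g0, g1) ≠ (0, 0) →
      (monLt (-1) (lm (-1) (f0 * h00 + f1 * h10) (f0 * h01 + f1 * h11))
          (lm (-1) (g0 * h00 + g1 * h10) (g0 * h01 + g1 * h11))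
        ↔ monLt w (lm w f0 f1) (lm w g0 g1)) := by
  intro f0 f1 g0 g1 hf hg
  rw [lm_neg_one_combination h00ne hd0 hd1 hw hf, lm_neg_one_combination h00ne hd0 hd1 hw hg]
  exact monLt_neg_one_map_add_iff hw _ _
end

section
/- Let K be a field, w an integer, and M ⊆ K[X]^2 a K[X]-submodule generated by g_0 = (g_{00}, g_{01}) and g_1 = (g_{10}, g_{11}) with lm_w(g_0) on the left (deg g_{00} ≥ deg g_{01} + w + 1) and lm_w(g_1) on the right (deg g_{11} > deg g_{10} − w − 1). Let D : K[X]^2 → K be a K-linear map such that M⁺ := M ∩ ker D is a K[X]-submodule, and set Δ_j := D(g_j) for j = 0,1. Define g_0⁺, g_1⁺ as follows: if Δ_j = 0 set g_j⁺ := g_j; if exactly one Δ_j ≠ 0 set g_j⁺ := Δ_j·X·g_j − D(X·g_j)·g_j for that j; if both Δ_0, Δ_1 ≠ 0, let j* ∈ {0,1} be the index with lm_w(g_{j*}) <_w lm_w(g_{1−j*}), and set g_{1−j*}⁺ := Δ_{j*}·g_{1−j*} − Δ_{1−j*}·g_{j*} and g_{j*}⁺ := Δ_{j*}·X·g_{j*}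 − D(X·g_{j*})·g_{j*}. Then {g_0⁺, g_1⁺} generates M⁺ as a K[X]-module, lm_w(g_0⁺) is on the left, and lm_w(g_1⁺) is on the right. -/
open Polynomial

theorem not_left_iff {F : Type*} [Field F] (w : ℤ) (u v : F[X]) :
    ¬ (degZ v + (w : WithBot ℤ) + 1 ≤ degZ u) ↔
      v ≠ 0 ∧ (u = 0 ∨ (u.natDegree : ℤ) ≤ v.natDegree + w) := by
  unfold degZ
  by_cases hv : v = 0
  · simp [hv]
  by_cases hu : u = 0
  · rw [degree_eq_natDegree hv]
    simp only [hu, hv, degree_zero, ne_eq, not_false_eq_true, true_or, and_true, iff_true]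
    change ¬ (((v.natDegree + w + 1 : ℤ) : WithBot ℤ) ≤ ⊥)
    exact not_le_of_gt (WithBot.bot_lt_coe _)
  · rw [degree_eq_natDegree hv, degree_eq_natDegree hu]
    change ¬ (((v.natDegree + w + 1 : ℤ) : WithBot ℤ) ≤ ((u.natDegree : ℤ) : WithBot ℤ)) ↔ _
    rw [WithBot.coe_le_coe]
    simp only [hu, hv, ne_eq, not_false_eq_true, true_and, false_or]
    lia

theorem left_iff {F : Type*} [Field F] (w : ℤ) (u v : F[X]) :
    degZ v + (w : WithBot ℤ) + 1 ≤ degZ u ↔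
      v = 0 ∨ (u ≠ 0 ∧ (v.natDegree : ℤ) + w + 1 ≤ u.natDegree) := by
  rw [← not_iff_not, not_left_iff]
  by_cases hv : v = 0 <;> by_cases hu : u = 0 <;> simp [hu, hv]

theorem left_mul_iff {F : Type*} [Field F] (w : ℤ) (u v : F[X]) {p : F[X]} (hp : p ≠ 0) :
    degZ (p * v) + (w : WithBot ℤ) + 1 ≤ degZ (p * u) ↔
      degZ v + (w : WithBot ℤ) + 1 ≤ degZ u := by
  rw [left_iff, left_iff]
  by_cases hv : v = 0
  · simp [hv]
  by_cases hu : u = 0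
  · simp [hu, hp]
  rw [natDegree_mul hp hv, natDegree_mul hp hu]
  simp only [mul_eq_zero, hp, hu, hv, ne_eq, or_self, not_false_eq_true, true_and, false_or]
  lia

theorem left_smul_X_smul_sub_iff {F : Type*} [Field F] (w : ℤ) (g : F[X] × F[X]) {a : F}
    (ha : a ≠ 0) (c : F) :
    degZ (a • ((X : F[X]) • g) - c • g).2 + (w : WithBot ℤ) + 1
        ≤ degZ (a • ((X : F[X]) • g) - c • g).1 ↔
      degZ g.2 + (w : WithBot ℤ) + 1 ≤ degZ g.1 := by
  have hp : C a * X - C c ≠ 0 := fun h => ha (by simpa using congrArg (coeff · 1) h)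
  rw [← left_mul_iff w g.1 g.2 hp]
  simp only [Prod.fst_sub, Prod.snd_sub, Prod.smul_fst, Prod.smul_snd, smul_eq_mul,
    smul_eq_C_mul, sub_mul, mul_assoc]

theorem natDegree_smul_sub_smul_of_lt {F : Type*} [Field F] {a : F} (ha : a ≠ 0) (b : F)
    {p q : F[X]} (hp : p ≠ 0) (h : q = 0 ∨ q.natDegree < p.natDegree) :
    a • p - b • q ≠ 0 ∧ (a • p - b • q).natDegree = p.natDegree := by
  have hlt : (b • q).degree < (a • p).degree := by
    rw [degree_smul_of_smul_regular p (IsSMulRegular.of_ne_zero ha)]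
    refine (degree_smul_le b q).trans_lt ?_
    rcases h with rfl | h
    · simpa using bot_lt_iff_ne_bot.2 (degree_ne_bot.2 hp)
    · exact degree_lt_degree h
  have hdeg : (a • p - b • q).degree = p.degree := by
    rw [degree_sub_eq_left_of_degree_lt hlt,
      degree_smul_of_smul_regular p (IsSMulRegular.of_ne_zero ha)]
  exact ⟨degree_ne_bot.1 (hdeg ▸ degree_ne_bot.2 hp), natDegree_eq_of_degree_eq hdeg⟩

theorem natDegree_smul_sub_smul_le {F : Type*} [Field F] (a b : F) (p q : F[X]) :
    (a • p - b • q).natDegree ≤ max p.natDegree q.natDegree :=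
  (natDegree_sub_le _ _).trans (max_le_max (natDegree_smul_le _ _) (natDegree_smul_le _ _))

theorem smul_sub_eval_smul_mem {F A : Type*} [Field F] [AddCommGroup A] [Module F A]
    [Module F[X] A] [IsScalarTower F F[X] A] {S : Submodule F[X] A} {g : A} {c : F}
    (h : (X : F[X]) • g - c • g ∈ S) (p : F[X]) : p • g - p.eval c • g ∈ S := by
  obtain ⟨q, hq⟩ := X_sub_C_dvd_sub_C_eval (a := c) (p := p)
  have hC (r : F) : r • g = (C r : F[X]) • g := by
    rw [← mul_one (C r), ← smul_eq_C_mul, smul_assoc, one_smul]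
  rw [hC, ← sub_smul] at h ⊢
  rw [hq, mul_comm, mul_smul]
  exact S.smul_mem q h

/-- If `D g ≠ 0`, then eliminating `D` from `X • g` and from `h` by multiples of `g` yields
generators of `span {g, h} ∩ ker D`, provided this is a submodule. -/
theorem span_pair_eq_of_eliminate {F A : Type*} [Field F] [AddCommGroup A] [Module F A]
    [Module F[X] A] [IsScalarTower F F[X] A] (D : A →ₗ[F] F) {M : Submodule F[X] A} {g h : A}
    (hM : ∀ x, x ∈ M ↔ x ∈ Submodule.span F[X] {g, h} ∧ D x = 0) (hg : D g ≠ 0)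
    {a b : F} (ha : a ≠ 0) (hD : D (a • h - b • g) = 0) :
    Submodule.span F[X] {D g • ((X : F[X]) • g) - D ((X : F[X]) • g) • g, a • h - b • g} = M := by
  set S := Submodule.span F[X]
    {D g • ((X : F[X]) • g) - D ((X : F[X]) • g) • g, a • h - b • g} with hS
  have hgN : g ∈ Submodule.span F[X] {g, h} := Submodule.subset_span (by simp)
  have hhN : h ∈ Submodule.span F[X] {g, h} := Submodule.subset_span (by simp)
  have hSM : S ≤ M := by
    rw [hS, Submodule.span_le, Set.insert_subset_iff, Set.singleton_subset_iff]
    refine ⟨(hM _).2 ⟨?_, ?_⟩, (hM _).2 ⟨?_, hD⟩⟩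
    · exact sub_mem (Submodule.smul_of_tower_mem _ _ (Submodule.smul_mem _ _ hgN))
        (Submodule.smul_of_tower_mem _ _ hgN)
    · simp only [map_sub, map_smul, smul_eq_mul]
      ring
    · exact sub_mem (Submodule.smul_of_tower_mem _ _ hhN) (Submodule.smul_of_tower_mem _ _ hgN)
  have hX : (X : F[X]) • g - ((D g)⁻¹ * D ((X : F[X]) • g)) • g ∈ S := by
    have := S.smul_of_tower_mem (D g)⁻¹ (Submodule.subset_span (Set.mem_insert _ _))
    rwa [smul_sub, inv_smul_smul₀ hg, smul_smul] at this
  have hh : h - (a⁻¹ * b) • g ∈ S := by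
    have := S.smul_of_tower_mem a⁻¹
      (Submodule.subset_span (Set.mem_insert_of_mem _ (Set.mem_singleton _)))
    rwa [smul_sub, inv_smul_smul₀ ha, smul_smul] at this
  refine le_antisymm hSM fun x hx => ?_
  obtain ⟨hxN, hxD⟩ := (hM x).1 hx
  obtain ⟨p, q, rfl⟩ := Submodule.mem_span_pair.1 hxN
  obtain ⟨c, hc⟩ : ∃ c : F, p • g + q • h - c • g ∈ S := by
    have h1 := smul_sub_eval_smul_mem hX (p + (a⁻¹ * b) • q)
    refine ⟨(p + (a⁻¹ * b) • q).eval ((D g)⁻¹ * D ((X : F[X]) • g)), ?_⟩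
    convert add_mem h1 (S.smul_mem q hh) using 1
    rw [add_smul, smul_assoc, smul_sub, smul_comm q (a⁻¹ * b) g]
    abel
  have hcD := ((hM _).1 (hSM hc)).2
  rw [map_sub, hxD, map_smul, smul_eq_mul, zero_sub, neg_eq_zero] at hcD
  rw [(mul_eq_zero.1 hcD).resolve_right hg, zero_smul, sub_zero] at hc
  exact hc

/-- correctness of Kötter's iteration (for `ℓ = 1` and the ordering `<_w`):
given a Gröbner basis `{g₀, g₁}` of `M` with `lm_w(g₀)` on the left and `lm_w(g₁)` on the
right, a `K`-linear functional `D` such that `M⁺ = M ∩ ker D` is a `K[X]`-submodule, and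
`g₀⁺, g₁⁺` defined by Kötter's update rules, the set `{g₀⁺, g₁⁺}` generates `M⁺`, with
`lm_w(g₀⁺)` on the left and `lm_w(g₁⁺)` on the right. -/
theorem stmt16 {K : Type*} [Field K] (w : ℤ)
    (g0 g1 g0p g1p : K[X] × K[X])
    (hlm0 : degZ g0.2 + (w : WithBot ℤ) + 1 ≤ degZ g0.1)
    (hlm1 : ¬ (degZ g1.2 + (w : WithBot ℤ) + 1 ≤ degZ g1.1))
    (D : (K[X] × K[X]) →ₗ[K] K)
    (Mp : Submodule K[X] (K[X] × K[X]))
    (hMp : (Mp : Set (K[X] × K[X]))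
      = ((Submodule.span K[X] {g0, g1} : Submodule K[X] (K[X] × K[X])) : Set (K[X] × K[X]))
        ∩ {p | D p = 0})
    (h00 : D g0 = 0 → g0p = g0)
    (h10 : D g1 = 0 → g1p = g1)
    (h0only : D g0 ≠ 0 → D g1 = 0 →
      g0p = D g0 • ((X : K[X]) • g0) - D ((X : K[X]) • g0) • g0)
    (h1only : D g1 ≠ 0 → D g0 = 0 →
      g1p = D g1 • ((X : K[X]) • g1) - D ((X : K[X]) • g1) • g1)
    (hboth0 : D g0 ≠ 0 → D g1 ≠ 0 → monLt w (lm w g0.1 g0.2) (lm w g1.1 g1.2) →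
      g0p = D g0 • ((X : K[X]) • g0) - D ((X : K[X]) • g0) • g0 ∧
      g1p = D g0 • g1 - D g1 • g0)
    (hboth1 : D g0 ≠ 0 → D g1 ≠ 0 → monLt w (lm w g1.1 g1.2) (lm w g0.1 g0.2) →
      g1p = D g1 • ((X : K[X]) • g1) - D ((X : K[X]) • g1) • g1 ∧
      g0p = D g1 • g0 - D g0 • g1) :
    Submodule.span K[X] {g0p, g1p} = Mp ∧
      degZ g0p.2 + (w : WithBot ℤ) + 1 ≤ degZ g0p.1 ∧
      ¬ (degZ g1p.2 + (w : WithBot ℤ) + 1 ≤ degZ g1p.1) := by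
  have hM : ∀ x, x ∈ Mp ↔ x ∈ Submodule.span K[X] {g0, g1} ∧ D x = 0 := fun x =>
    Set.ext_iff.1 hMp x
  have hM' : ∀ x, x ∈ Mp ↔ x ∈ Submodule.span K[X] {g1, g0} ∧ D x = 0 := by
    rwa [Set.pair_comm]
  by_cases hD0 : D g0 = 0 <;> by_cases hD1 : D g1 = 0
  · rw [h00 hD0, h10 hD1]
    refine ⟨le_antisymm ?_ fun x hx => ((hM x).1 hx).1, hlm0, hlm1⟩
    rw [Submodule.span_le, Set.insert_subset_iff, Set.singleton_subset_iff]
    exact ⟨(hM _).2 ⟨Submodule.subset_span (by simp), hD0⟩,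
      (hM _).2 ⟨Submodule.subset_span (by simp), hD1⟩⟩
  · rw [h00 hD0, h1only hD1 hD0, left_smul_X_smul_sub_iff w g1 hD1]
    refine ⟨?_, hlm0, hlm1⟩
    have := span_pair_eq_of_eliminate D hM' hD1 (a := 1) (b := 0) one_ne_zero (by simpa using hD0)
    rwa [one_smul, zero_smul, sub_zero, Set.pair_comm] at this
  · rw [h10 hD1, h0only hD0 hD1, left_smul_X_smul_sub_iff w g0 hD0]
    refine ⟨?_, hlm0, hlm1⟩
    have := span_pair_eq_of_eliminate D hM hD0 (a := 1) (b := 0) one_ne_zero (by simpa using hD1)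
    rwa [one_smul, zero_smul, sub_zero] at this
  have hl0 : lm w g0.1 g0.2 = Sum.inl g0.1.natDegree := if_pos hlm0
  have hl1 : lm w g1.1 g1.2 = Sum.inr g1.2.natDegree := if_neg hlm1
  rw [hl0, hl1] at hboth0 hboth1
  obtain ⟨hv1, hu1⟩ := (not_left_iff _ _ _).1 hlm1
  have hv0 := (left_iff _ _ _).1 hlm0
  have hu0 : g0.1 ≠ 0 := by
    intro h
    have : g0 = 0 := Prod.ext h (hv0.resolve_right fun h' => h'.1 h)
    exact hD0 (by rw [this, map_zero])
  rcases le_or_gt (g0.1.natDegree : ℤ) (g1.2.natDegree + w) with hle | hlt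
  · obtain ⟨rfl, rfl⟩ := hboth0 hD0 hD1 hle
    rw [left_smul_X_smul_sub_iff w g0 hD0]
    refine ⟨span_pair_eq_of_eliminate D hM hD0 hD0
      (by simp only [map_sub, map_smul, smul_eq_mul]; ring), hlm0, ?_⟩
    obtain ⟨hne, hdeg⟩ := natDegree_smul_sub_smul_of_lt (p := g1.2) (q := g0.2) hD0 (D g1) hv1
      (hv0.imp_right (by lia))
    rw [not_left_iff]
    refine ⟨hne, Or.inr ?_⟩
    have hmax := natDegree_smul_sub_smul_le (D g0) (D g1) g1.1 g0.1
    simp only [Prod.fst_sub, Prod.snd_sub, Prod.smul_fst, Prod.smul_snd, hdeg]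
    rcases hu1 with h | h
    · rw [h, natDegree_zero] at hmax
      rw [h]
      lia
    · lia
  · obtain ⟨rfl, rfl⟩ := hboth1 hD0 hD1 hlt
    rw [left_smul_X_smul_sub_iff w g1 hD1]
    refine ⟨?_, ?_, hlm1⟩
    · rw [Set.pair_comm]
      exact span_pair_eq_of_eliminate D hM' hD1 hD1
        (by simp only [map_sub, map_smul, smul_eq_mul]; ring)
    obtain ⟨hne, hdeg⟩ := natDegree_smul_sub_smul_of_lt (p := g0.1) (q := g1.1) hD1 (D g0) hu0
      (hu1.imp_right (by lia))
    rw [left_iff]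
    refine Or.inr ⟨hne, ?_⟩
    have hmax := natDegree_smul_sub_smul_le (D g1) (D g0) g0.2 g1.2
    simp only [Prod.fst_sub, Prod.snd_sub, Prod.smul_fst, Prod.smul_snd, hdeg]
    rcases hv0 with h | h
    · rw [h, natDegree_zero] at hmax
      rw [h]
      lia
    · lia
end

section
/- Let t ≥ 1, let S(X) = Σ_{j=0}^{2t−1} S_j X^j ∈ F[X], and let v(X) = Σ_{i=0}^{δ} v_i X^i ∈ F[X] with δ = deg v ≤ 2t−1. Let β ∈ F satisfy v(β) = 0. Then the remainder of S·v upon division by X^{2t}, evaluated at β, equals Σ_{j=2t−δ}^{2t−1} S_j β^j (Σ_{i=0}^{2t−1−j} v_i β^i). -/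
open Polynomial

theorem coeff_modByMonic_X_pow_of_lt {R : Type*} [CommRing R] (p : R[X]) {n k : ℕ} (hk : k < n) :
    (p %ₘ X ^ n).coeff k = p.coeff k := by
  conv_rhs => rw [← modByMonic_add_div p (X ^ n)]
  rw [coeff_add, coeff_X_pow_mul', if_neg hk.not_ge, add_zero]

theorem eval_mul_modByMonic_X_pow {R : Type*} [CommRing R] [Nontrivial R] (p q : R[X]) (n : ℕ)
    (x : R) :
    ((p * q) %ₘ X ^ n).eval x =
      ∑ j ∈ Finset.range n, p.coeff j * x ^ j *
        ∑ i ∈ Finset.range (n - j), q.coeff i * x ^ i := by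
  have hsum : ((p * q) %ₘ X ^ n).eval x =
      ∑ k ∈ Finset.range n, ((p * q) %ₘ X ^ n).coeff k * x ^ k := by
    have hdeg : ((p * q) %ₘ X ^ n).degree < n := by
      simpa using degree_modByMonic_lt (p * q) (monic_X_pow (R := R) n)
    rw [eval_eq_sum]
    refine Finset.sum_subset (fun k hk => ?_) fun k _ hk => by simp [notMem_support_iff.1 hk]
    exact Finset.mem_range.2 (by exact_mod_cast (le_degree_of_mem_supp k hk).trans_lt hdeg)
  simp_rw [Finset.mul_sum]
  rw [← Finset.sum_range_diag_flip n
    (fun j i => p.coeff j * x ^ j * (q.coeff i * x ^ i)), hsum]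
  refine Finset.sum_congr rfl fun k hk => ?_
  rw [coeff_modByMonic_X_pow_of_lt _ (Finset.mem_range.1 hk), coeff_mul,
    Finset.Nat.sum_antidiagonal_eq_sum_range_succ (fun i j => p.coeff i * q.coeff j),
    Finset.sum_mul]
  refine Finset.sum_congr rfl fun i hi => ?_
  rw [← pow_mul_pow_sub x (Finset.mem_range_succ_iff.1 hi)]
  ring

/-- for `S` of degree `< 2t`, `v` of degree `δ ≤ 2t-1` and `β` with
`v(β) = 0`, the remainder of `S·v` modulo `X^{2t}`, evaluated at `β`, equals
`Σ_{j=2t-δ}^{2t-1} S_j β^j (Σ_{i=0}^{2t-1-j} v_i β^i)`. -/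
theorem stmt17 {F : Type*} [Field F] (t : ℕ) (ht : 1 ≤ t)
    (S v : F[X])
    (hS : S.degree < (2 * t : ℕ))
    (hv : v.natDegree ≤ 2 * t - 1)
    (β : F) (hβ : v.eval β = 0) :
    ((S * v) %ₘ (X ^ (2 * t))).eval β =
      ∑ j ∈ Finset.Icc (2 * t - v.natDegree) (2 * t - 1),
        S.coeff j * β ^ j * ∑ i ∈ Finset.range (2 * t - j), v.coeff i * β ^ i := by
  rw [eval_mul_modByMonic_X_pow]
  refine (Finset.sum_subset (fun j hj => ?_) fun j hj hj' => ?_).symm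
  · rw [Finset.mem_Icc] at hj
    rw [Finset.mem_range]
    omega
  · rw [Finset.mem_range] at hj
    rw [Finset.mem_Icc] at hj'
    rw [← eval_eq_sum_range' (by omega), hβ, mul_zero]
end
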